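/- Under the standing assumptions, for every δ > 0 there is a constant C = C(δ, d) such that for all distinct z₁, z₂ ∈ (1−δ)𝔹 the two-point function satisfies |k₂(z₁, z₂)| ≤ C(1 + s(|z₁ − z₂|)). -/

import Mathlib

open MeasureTheory ProbabilityTheory Metric Filter Topology Set

noncomputable section

abbrev Euc (d : ℕ) : Type := EuclideanSpace ℝ (Fin d)

/-- The scaling function `s`: `s(r) = -log r` if `d = 2`, and `s(r) = r^(2-d)` if `d ≥ 3`. -/
noncomputable def sFun (d : ℕ) (r : ℝ) : ℝ :=
  if d = 2 then -Real.log r else r ^ ((2 : ℝ) - (d : ℝ))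

open Classical in
/-- The zero boundary Green's function of the open unit ball in `ℝ^d`:
`G(x,y) = s(|x-y|) - s(|x|·|y - x/|x|²|)`, interpreted by continuity at `x = 0`. -/
noncomputable def greenBall (d : ℕ) (x y : Euc d) : ℝ :=
  if x = 0 then sFun d ‖y‖ - sFun d 1
  else sFun d ‖x - y‖ - sFun d (‖x‖ * ‖y - (‖x‖ ^ 2)⁻¹ • x‖)

/-- Smooth compactly supported test functions. -/
def IsTestFun {d : ℕ} (f : Euc d → ℝ) : Prop :=
  ContDiff ℝ (⊤ : ℕ∞) f ∧ HasCompactSupport f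

/-- The Laplacian of `u : ℝ^d → ℝ` at `x`, as the sum of pure second derivatives in the
coordinate directions. -/
noncomputable def lap {d : ℕ} (u : Euc d → ℝ) (x : Euc d) : ℝ :=
  ∑ i : Fin d, iteratedFDeriv ℝ 2 u x ![EuclideanSpace.single i 1, EuclideanSpace.single i 1]

/-- A function is harmonic on a set if it is twice continuously differentiable there with
vanishing Laplacian. -/
def IsHarmonicOn {d : ℕ} (u : Euc d → ℝ) (s : Set (Euc d)) : Prop :=
  ContDiffOn ℝ 2 u s ∧ ∀ x ∈ s, lap u x = 0

/-- A real random variable is a (possibly degenerate) centered Gaussian. -/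
def IsCenteredGaussianRV {Ω : Type} [MeasurableSpace Ω] (P : Measure Ω) (Y : Ω → ℝ) : Prop :=
  ∃ v : NNReal, Measure.map Y P = ProbabilityTheory.gaussianReal 0 v

/-- The standing assumptions: a collection of stochastic processes `h a r` (thought of as
`h^{a + r𝔹}`) indexed by test functions, which is centered, a.s. linear, zero outside the ball,
translation/scaling covariant, satisfies the domain Markov property (with the decomposition
recorded as data `H`, `Φ`, `φharm`), has fourth moments, a (sequentially) continuous covariance
bilinear form on `C_c^∞(𝔹)`, and zero boundary conditions. -/
structure GFF (d : ℕ) (Ω : Type) [MeasurableSpace Ω] where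
  P : Measure Ω
  prob : IsProbabilityMeasure P
  /-- the field `h^{a+r𝔹}` tested against `f` -/
  h : Euc d → ℝ → (Euc d → ℝ) → Ω → ℝ
  meas_h : ∀ a r f, Measurable (h a r f)
  integrable_h : ∀ a r f, IsTestFun f → Integrable (h a r f) P
  /-- centered -/
  centered : ∀ a r f, IsTestFun f → ∫ ω, h a r f ω ∂P = 0
  /-- (1) a.s. linearity in the test function -/
  lin_add : ∀ f g : Euc d → ℝ, IsTestFun f → IsTestFun g →
    ∀ᵐ ω ∂P, h 0 1 (f + g) ω = h 0 1 f ω + h 0 1 g ω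
  lin_smul : ∀ (c : ℝ) (f : Euc d → ℝ), IsTestFun f →
    ∀ᵐ ω ∂P, h 0 1 (c • f) ω = c * h 0 1 f ω
  /-- (2) the field vanishes on test functions supported outside the ball -/
  zero_outside : ∀ f : Euc d → ℝ, IsTestFun f → tsupport f ⊆ (ball (0 : Euc d) 1)ᶜ →
    ∀ᵐ ω ∂P, h 0 1 f ω = 0
  /-- (3) translation and scaling: `(h^{a+r𝔹}, f((·-a)/r)) = r^{1+d/2} (h^𝔹, f)` in law,
  as processes (equality of finite dimensional distributions) -/
  scaling : ∀ (a : Euc d) (r : ℝ), 0 < r → ∀ (k : ℕ) (f : Fin k → Euc d → ℝ),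
    (∀ i, IsTestFun (f i)) →
    Measure.map (fun ω (i : Fin k) => h a r (fun x => f i (r⁻¹ • (x - a))) ω) P
      = Measure.map (fun ω (i : Fin k) => r ^ (1 + (d : ℝ) / 2) * h 0 1 (f i) ω) P
  /-- (4) domain Markov property: the decomposition data. `H a r` is the independent copy of
  `h^{a+r𝔹}`, `Φ a r` is the harmonic part as a process, `φharm a r ω` is the harmonic function. -/
  H : Euc d → ℝ → (Euc d → ℝ) → Ω → ℝ
  Φ : Euc d → ℝ → (Euc d → ℝ) → Ω → ℝ
  φharm : Euc d → ℝ → Ω → Euc d → ℝ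
  meas_H : ∀ a r f, Measurable (H a r f)
  meas_Φ : ∀ a r f, Measurable (Φ a r f)
  meas_φharm : ∀ a r z, Measurable fun ω => φharm a r ω z
  dmp_decomp : ∀ (a : Euc d) (r : ℝ), 0 < r → ball a r ⊆ ball (0 : Euc d) 1 →
    ∀ f : Euc d → ℝ, IsTestFun f → ∀ᵐ ω ∂P, h 0 1 f ω = H a r f ω + Φ a r f ω
  dmp_indep : ∀ (a : Euc d) (r : ℝ), 0 < r → ball a r ⊆ ball (0 : Euc d) 1 →
    ProbabilityTheory.Indep
      (⨆ f : {f : Euc d → ℝ // IsTestFun f}, MeasurableSpace.comap (H a r f.1) inferInstance)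
      ((⨆ f : {f : Euc d → ℝ // IsTestFun f}, MeasurableSpace.comap (Φ a r f.1) inferInstance) ⊔
        (⨆ z : Euc d, MeasurableSpace.comap (fun ω => φharm a r ω z) inferInstance)) P
  dmp_law : ∀ (a : Euc d) (r : ℝ), 0 < r → ball a r ⊆ ball (0 : Euc d) 1 →
    ∀ (k : ℕ) (f : Fin k → Euc d → ℝ), (∀ i, IsTestFun (f i)) →
    Measure.map (fun ω (i : Fin k) => H a r (f i) ω) P
      = Measure.map (fun ω (i : Fin k) => h a r (f i) ω) P
  dmp_harm : ∀ (a : Euc d) (r : ℝ), 0 < r → ball a r ⊆ ball (0 : Euc d) 1 →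
    ∀ᵐ ω ∂P, IsHarmonicOn (φharm a r ω) (ball a r) ∧
      ∀ f : Euc d → ℝ, IsTestFun f → tsupport f ⊆ ball a r →
        Φ a r f ω = ∫ x in ball a r, φharm a r ω x * f x
  /-- (5) fourth moments -/
  mom4 : ∀ f : Euc d → ℝ, IsTestFun f → Integrable (fun ω => (h 0 1 f ω) ^ 4) P
  /-- (6) sequential continuity of the covariance bilinear form on `C_c^∞(𝔹)` -/
  K2_cont : ∀ (f : ℕ → Euc d → ℝ) (f₀ g : Euc d → ℝ) (K : Set (Euc d)),
    IsCompact K → K ⊆ ball (0 : Euc d) 1 →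
    (∀ n, IsTestFun (f n)) → IsTestFun f₀ → IsTestFun g → tsupport g ⊆ ball (0 : Euc d) 1 →
    (∀ n, tsupport (f n) ⊆ K) → tsupport f₀ ⊆ K →
    (∀ m : ℕ, TendstoUniformly (fun n => iteratedFDeriv ℝ m (f n)) (iteratedFDeriv ℝ m f₀) atTop) →
    Tendsto (fun n => ∫ ω, h 0 1 (f n) ω * h 0 1 g ω ∂P) atTop
      (𝓝 (∫ ω, h 0 1 f₀ ω * h 0 1 g ω ∂P))
  /-- (7) zero boundary conditions -/
  zero_bdry : ∀ f : ℕ → Euc d → ℝ,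
    (∀ n, IsTestFun (f n)) → (∀ n x, 0 ≤ f n x) →
    (∃ C : ℝ, ∀ n, ∫ x, f n x ≤ C) →
    Tendsto (fun n => Metric.infDist (0 : Euc d) (tsupport (f n))) atTop (𝓝 1) →
    (∃ C : ℝ, ∀ (n : ℕ) (x y : Euc d), ‖x‖ = ‖y‖ → ‖x‖ < 1 → f n x ≤ C * f n y) →
    Tendsto (fun n => ∫ ω, (h 0 1 (f n) ω) ^ 2 ∂P) atTop (𝓝 0)

instance {d : ℕ} {Ω : Type} [MeasurableSpace Ω] (X : GFF d Ω) : IsProbabilityMeasure X.P :=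
  X.prob

/-- A valid choice of radius in the definition of the two-point function. -/
noncomputable def k2eps {d : ℕ} (z₁ z₂ : Euc d) : ℝ :=
  min (dist z₁ z₂ / 2) (min (1 - ‖z₁‖) (1 - ‖z₂‖)) / 2

/-- The two-point function `k₂(z₁,z₂) = E[φ^{z₁+ε𝔹}_𝔹(z₁) φ^{z₂+ε𝔹}_𝔹(z₂)]`
(independent of the admissible choice of `ε`, under the standing assumptions). -/
noncomputable def GFF.k2 {d : ℕ} {Ω : Type} [MeasurableSpace Ω] (X : GFF d Ω) (z₁ z₂ : Euc d) : ℝ :=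
  ∫ ω, X.φharm z₁ (k2eps z₁ z₂) ω z₁ * X.φharm z₂ (k2eps z₁ z₂) ω z₂ ∂X.P


/-- A smooth radial cutoff supported in the ball of radius `1/2`. -/
def radialCutoff (d : ℕ) (y : Euc d) : ℝ := Real.smoothTransition (1 - 4 * ‖y‖ ^ 2)

/-- The smooth nonnegative radial kernel whose product with `y` is `-∇ radialCutoff`. -/
def radialKernel (d : ℕ) (y : Euc d) : ℝ := 8 * deriv Real.smoothTransition (1 - 4 * ‖y‖ ^ 2)

/-- The radial kernel recentred at `a` and rescaled by `s`. -/
def scaledKernel (d : ℕ) (a : Euc d) (s : ℝ) (x : Euc d) : ℝ := radialKernel d (s⁻¹ • (x - a))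

lemma contDiff_radialCutoff (d : ℕ) : ContDiff ℝ (⊤ : ℕ∞) (radialCutoff d) := by
  unfold radialCutoff
  exact Real.smoothTransition.contDiff.comp
    (contDiff_const.sub (contDiff_const.mul (contDiff_norm_sq ℝ)))

lemma contDiff_radialKernel (d : ℕ) : ContDiff ℝ (⊤ : ℕ∞) (radialKernel d) := by
  unfold radialKernel
  have h : ContDiff ℝ (⊤ : ℕ∞) (deriv Real.smoothTransition) :=
    (contDiff_infty_iff_deriv.1 Real.smoothTransition.contDiff).2
  exact contDiff_const.mul (h.comp (contDiff_const.sub (contDiff_const.mul (contDiff_norm_sq ℝ))))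

lemma radialCutoff_eq_zero {d : ℕ} {y : Euc d} (hy : 1 / 2 ≤ ‖y‖) : radialCutoff d y = 0 :=
  Real.smoothTransition.zero_of_nonpos (by nlinarith)

lemma radialKernel_eq_zero {d : ℕ} {y : Euc d} (hy : 1 / 2 < ‖y‖) : radialKernel d y = 0 := by
  have h : Real.smoothTransition =ᶠ[𝓝 (1 - 4 * ‖y‖ ^ 2)] fun _ => 0 := by
    filter_upwards [Iio_mem_nhds (show 1 - 4 * ‖y‖ ^ 2 < 0 by nlinarith)] with x hx
    exact Real.smoothTransition.zero_of_nonpos (le_of_lt hx)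
  simp [radialKernel, h.deriv_eq]

lemma radialKernel_nonneg (d : ℕ) (y : Euc d) : 0 ≤ radialKernel d y :=
  mul_nonneg (by norm_num) Real.smoothTransition.monotone.deriv_nonneg

lemma hasCompactSupport_radialCutoff (d : ℕ) : HasCompactSupport (radialCutoff d) :=
  HasCompactSupport.intro (isCompact_closedBall 0 (1 / 2)) fun y hy =>
    radialCutoff_eq_zero (by simpa using (not_le.1 (by simpa using hy)).le)

lemma hasCompactSupport_radialKernel (d : ℕ) : HasCompactSupport (radialKernel d) :=
  HasCompactSupport.intro (isCompact_closedBall 0 (1 / 2)) fun y hy =>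
    radialKernel_eq_zero (by simpa using hy)

lemma fderiv_radialCutoff {d : ℕ} (y v : Euc d) :
    fderiv ℝ (radialCutoff d) y v = -(radialKernel d y * inner ℝ y v) := by
  have h1 : HasDerivAt Real.smoothTransition (deriv Real.smoothTransition (1 - 4 * ‖y‖ ^ 2))
      (1 - 4 * ‖y‖ ^ 2) :=
    ((Real.smoothTransition.contDiff (n := 1)).differentiable (by norm_num) _).hasDerivAt
  have h2 : HasFDerivAt (fun y : Euc d => 1 - 4 * ‖y‖ ^ 2)
      (-((4 : ℝ) • ((2 : ℝ) • innerSL ℝ y))) y := by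
    have := ((hasStrictFDerivAt_norm_sq y).hasFDerivAt.const_mul (4 : ℝ)).const_sub 1
    simpa [two_smul] using this
  have h3 := h1.comp_hasFDerivAt y h2
  have h4 : fderiv ℝ (radialCutoff d) y = _ := h3.fderiv
  rw [h4]
  simp [radialKernel]
  ring

lemma integral_radialKernel_pos {d : ℕ} (hd : 2 ≤ d) : 0 < ∫ y, radialKernel d y := by
  have : ∃ y, radialKernel d y ≠ 0 := by
    by_contra! h
    have hconst := is_const_of_fderiv_eq_zero
      ((contDiff_radialCutoff d).differentiable (by norm_num))
      (fun y => by ext v; simp [fderiv_radialCutoff, h]) (0 : Euc d)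
      (EuclideanSpace.single (⟨0, by lia⟩ : Fin d) (1 : ℝ))
    rw [radialCutoff_eq_zero (y := EuclideanSpace.single _ _) (by simp; norm_num)] at hconst
    simp [radialCutoff] at hconst
  obtain ⟨y, hy⟩ := this
  exact (contDiff_radialKernel d).continuous.integral_pos_of_hasCompactSupport_nonneg_nonzero
    (hasCompactSupport_radialKernel d) (radialKernel_nonneg d) hy

lemma isTestFun_radialKernel (d : ℕ) : IsTestFun (radialKernel d) :=
  ⟨contDiff_radialKernel d, hasCompactSupport_radialKernel d⟩

lemma IsTestFun.comp_affine {d : ℕ} {f : Euc d → ℝ} (hf : IsTestFun f) (a : Euc d) {s : ℝ}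
    (hs : 0 < s) : IsTestFun fun x => f (s⁻¹ • (x - a)) := by
  refine ⟨hf.1.comp ((contDiff_id.sub contDiff_const).const_smul s⁻¹), ?_⟩
  exact hf.2.comp_homeomorph
    ((Homeomorph.subRight a).trans (Homeomorph.smulOfNeZero s⁻¹ (inv_ne_zero hs.ne')))

lemma isTestFun_scaledKernel {d : ℕ} (a : Euc d) {s : ℝ} (hs : 0 < s) :
    IsTestFun (scaledKernel d a s) :=
  (isTestFun_radialKernel d).comp_affine a hs

lemma scaledKernel_eq_zero {d : ℕ} {a x : Euc d} {s : ℝ} (hs : 0 < s) (hx : s / 2 < ‖x - a‖) :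
    scaledKernel d a s x = 0 := by
  apply radialKernel_eq_zero
  rw [norm_smul, norm_inv, Real.norm_of_nonneg hs.le, inv_mul_eq_div, lt_div_iff₀ hs]
  linarith

lemma tsupport_scaledKernel {d : ℕ} (a : Euc d) {s : ℝ} (hs : 0 < s) :
    tsupport (scaledKernel d a s) ⊆ closedBall a (s / 2) := by
  refine closure_minimal (fun x hx => ?_) isClosed_closedBall
  by_contra h
  exact hx (scaledKernel_eq_zero hs (by simpa [dist_eq_norm] using h))

lemma hasDerivAt_integral_mul_radialKernel {d : ℕ} {w : Euc d → ℝ} (hw : ContDiff ℝ 2 w)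
    (a : Euc d) (t₀ : ℝ) :
    HasDerivAt (fun t : ℝ => ∫ y, w (a + t • y) * radialKernel d y)
      (∫ y, fderiv ℝ w (a + t₀ • y) y * radialKernel d y) t₀ := by
  have hw1 : ContDiff ℝ 1 (fderiv ℝ w) := hw.fderiv_right (by norm_num)
  have hwd : Differentiable ℝ w := hw.differentiable (by norm_num)
  have hKc := (contDiff_radialKernel d).continuous
  have hcont : Continuous fun p : ℝ × Euc d =>
      fderiv ℝ w (a + p.1 • p.2) p.2 * radialKernel d p.2 := by
    have := hw1.continuous
    fun_prop
  obtain ⟨C, hC⟩ := ((isCompact_closedBall t₀ 1).prod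
    (isCompact_closedBall (0 : Euc d) (1 / 2))).exists_bound_of_continuousOn hcont.continuousOn
  refine (hasDerivAt_integral_of_dominated_loc_of_deriv_le
    (bound := (closedBall (0 : Euc d) (1 / 2)).indicator fun _ => C)
    (F' := fun t y => fderiv ℝ w (a + t • y) y * radialKernel d y)
    (ball_mem_nhds t₀ one_pos) ?_ ?_ ?_ ?_ ?_ ?_).2
  · refine Eventually.of_forall fun t => Continuous.aestronglyMeasurable ?_
    have := hw.continuous
    fun_prop
  · refine Continuous.integrable_of_hasCompactSupport ?_
      (hasCompactSupport_radialKernel d).mul_left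
    have := hw.continuous
    fun_prop
  · exact (hcont.comp (Continuous.prodMk_right t₀)).aestronglyMeasurable
  · refine Eventually.of_forall fun y t ht => ?_
    by_cases hy : y ∈ closedBall (0 : Euc d) (1 / 2)
    · rw [indicator_of_mem hy]
      exact hC (t, y) ⟨ball_subset_closedBall ht, hy⟩
    · rw [indicator_of_notMem hy, radialKernel_eq_zero (by simpa using hy)]
      simp
  · exact (integrable_indicator_iff measurableSet_closedBall).2
      (integrableOn_const (isCompact_closedBall _ _).measure_lt_top.ne)
  · refine Eventually.of_forall fun y t _ => ?_
    have h1 : HasDerivAt (fun t : ℝ => a + t • y) y t := by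
      simpa using ((hasDerivAt_id t).smul_const y).const_add a
    exact ((hwd _).hasFDerivAt.comp_hasDerivAt t h1).mul_const _

/-- The smooth kernel average of a `C²` function that is harmonic near the support does not
depend on the scale. -/
lemma integral_mul_radialKernel {d : ℕ} {w : Euc d → ℝ} (hw : ContDiff ℝ 2 w) (a : Euc d) {s : ℝ}
    (hs : 0 < s) (hlap : ∀ x, ‖x - a‖ ≤ s / 2 → lap w x = 0) :
    ∫ y, w (a + s • y) * radialKernel d y = w a * ∫ y, radialKernel d y := by
  have hw1 : ContDiff ℝ 1 (fderiv ℝ w) := hw.fderiv_right (by norm_num)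
  have hψ := contDiff_radialCutoff d
  have hψd : Differentiable ℝ (radialCutoff d) := hψ.differentiable (by norm_num)
  have hzero : ∀ t ∈ Ico 0 s, ∫ y, fderiv ℝ w (a + t • y) y * radialKernel d y = 0 := by
    intro t ht
    let e : Fin d → Euc d := fun i => EuclideanSpace.single i 1
    have hg : ∀ i, ContDiff ℝ 1 fun y : Euc d => fderiv ℝ w (a + t • y) (e i) := fun i =>
      (hw1.comp (contDiff_const.add (contDiff_id.const_smul t))).clm_apply contDiff_const
    have hgd : ∀ i y, fderiv ℝ (fun y : Euc d => fderiv ℝ w (a + t • y) (e i)) y (e i)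
        = t * fderiv ℝ (fderiv ℝ w) (a + t • y) (e i) (e i) := by
      intro i y
      have h1 : HasFDerivAt (fun y : Euc d => a + t • y) (t • ContinuousLinearMap.id ℝ (Euc d)) y :=
        ((hasFDerivAt_id y).const_smul t).const_add a
      have h2 := ((hw1.differentiable (by norm_num) (a + t • y)).hasFDerivAt.comp y h1).clm_apply
        (hasFDerivAt_const (e i) y)
      have h3 : fderiv ℝ (fun y : Euc d => fderiv ℝ w (a + t • y) (e i)) y = _ := h2.fderiv
      rw [h3]
      simp
    have hpt : ∀ y, fderiv ℝ w (a + t • y) y * radialKernel d y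
        = -∑ i, fderiv ℝ w (a + t • y) (e i) * fderiv ℝ (radialCutoff d) y (e i) := by
      intro y
      have hy : y = ∑ i, y i • e i := by
        ext j
        simp [e, Pi.single_apply]
      have hL := congrArg (fderiv ℝ w (a + t • y)) hy
      simp only [map_sum, map_smul, smul_eq_mul] at hL
      rw [hL, Finset.sum_mul, ← Finset.sum_neg_distrib]
      refine Finset.sum_congr rfl fun i _ => ?_
      rw [fderiv_radialCutoff]
      simp [e, EuclideanSpace.inner_single_right]
      ring
    have hint1 : ∀ i, Integrable fun y : Euc d =>
        fderiv ℝ w (a + t • y) (e i) * fderiv ℝ (radialCutoff d) y (e i) := fun i =>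
      ((hg i).continuous.mul ((hψ.continuous_fderiv (by norm_num)).clm_apply
        continuous_const)).integrable_of_hasCompactSupport
        (((hasCompactSupport_radialCutoff d).fderiv_apply ℝ (e i)).mul_left)
    have hint2 : ∀ i, Integrable fun y : Euc d =>
        fderiv ℝ (fun y : Euc d => fderiv ℝ w (a + t • y) (e i)) y (e i) * radialCutoff d y :=
      fun i => ((((hg i).continuous_fderiv (by norm_num)).clm_apply continuous_const).mul
        hψ.continuous).integrable_of_hasCompactSupport
        (hasCompactSupport_radialCutoff d).mul_left
    have hint3 : ∀ i, Integrable fun y : Euc d =>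
        fderiv ℝ w (a + t • y) (e i) * radialCutoff d y :=
      fun i => ((hg i).continuous.mul hψ.continuous).integrable_of_hasCompactSupport
        (hasCompactSupport_radialCutoff d).mul_left
    simp_rw [hpt]
    rw [integral_neg, integral_finsetSum _ fun i _ => hint1 i]
    simp_rw [fun i => integral_mul_fderiv_eq_neg_fderiv_mul_of_integrable (hint2 i) (hint1 i)
      (hint3 i) (fun x _ => (hg i).differentiable (by norm_num) x) (fun x _ => hψd x)]
    rw [Finset.sum_neg_distrib, neg_neg, ← integral_finsetSum _ fun i _ => hint2 i]
    refine integral_eq_zero_of_ae (Eventually.of_forall fun y => ?_)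
    simp only [hgd, Pi.zero_apply]
    rw [← Finset.sum_mul, ← Finset.mul_sum]
    by_cases hy : 1 / 2 ≤ ‖y‖
    · rw [radialCutoff_eq_zero hy, mul_zero]
    · have := hlap (a + t • y) (by
        rw [add_sub_cancel_left, norm_smul, Real.norm_of_nonneg ht.1]
        nlinarith [ht.1, ht.2, norm_nonneg y])
      simp only [lap, iteratedFDeriv_two_apply, Matrix.cons_val_zero, Matrix.cons_val_one] at this
      simp only [e, this, mul_zero, zero_mul]
  have hconst := constant_of_has_deriv_right_zero (a := 0) (b := s)
    (f := fun t : ℝ => ∫ y, w (a + t • y) * radialKernel d y)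
    (fun t _ => (hasDerivAt_integral_mul_radialKernel hw a t).continuousAt.continuousWithinAt)
    (fun t ht => by
      have := (hasDerivAt_integral_mul_radialKernel hw a t).hasDerivWithinAt (s := Ici t)
      rwa [hzero t ht] at this) s ⟨hs.le, le_rfl⟩
  simpa [integral_const_mul] using hconst

/-- Mean value property of harmonic functions against the radial kernel. -/
lemma setIntegral_mul_scaledKernel {d : ℕ} {u : Euc d → ℝ} {a : Euc d} {r s : ℝ} (hs : 0 < s)
    (hsr : s ≤ r) (hu : IsHarmonicOn u (ball a r)) :
    ∫ x in ball a r, u x * scaledKernel d a s x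
      = s ^ d * (∫ y, radialKernel d y) * u a := by
  let χ : ContDiffBump a := ⟨s * (3 / 4), s * (7 / 8), by positivity, by nlinarith⟩
  let w : Euc d → ℝ := fun x => χ x * u x
  have hws : ∀ x ∈ ball a (s * (3 / 4)), w x = u x := fun x hx => by
    simp only [w]
    rw [χ.one_of_mem_closedBall (ball_subset_closedBall hx), one_mul]
  have hw : ContDiff ℝ 2 w := by
    rw [contDiff_iff_contDiffAt]
    intro x
    by_cases hx : x ∈ ball a r
    · exact χ.contDiff.contDiffAt.mul (hu.1.contDiffAt (isOpen_ball.mem_nhds hx))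
    · have hx' : x ∉ tsupport χ := by
        rw [χ.tsupport_eq]
        intro h
        apply hx
        rw [mem_closedBall] at h
        rw [mem_ball]
        change _ ≤ s * (7 / 8) at h
        nlinarith
      have : w =ᶠ[𝓝 x] fun _ => 0 := by
        filter_upwards [(notMem_tsupport_iff_eventuallyEq.1 hx')] with y hy
        simp [w, hy]
      exact contDiffAt_const.congr_of_eventuallyEq this
  have hlap : ∀ x, ‖x - a‖ ≤ s / 2 → lap w x = 0 := by
    intro x hx
    have hx1 : x ∈ ball a (s * (3 / 4)) := by
      rw [mem_ball, dist_eq_norm]; linarith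
    have hE : w =ᶠ[𝓝 x] u := by
      filter_upwards [isOpen_ball.mem_nhds hx1] with y hy using hws y hy
    have : lap w x = lap u x := by
      simp only [lap, (hE.iteratedFDeriv ℝ 2).eq_of_nhds]
    rw [this]
    exact hu.2 x (by rw [mem_ball, dist_eq_norm]; linarith)
  have key := integral_mul_radialKernel hw a hs hlap
  rw [hws a (mem_ball_self (by positivity))] at key
  have h1 : ∀ x, x ∉ ball a r → u x * scaledKernel d a s x = 0 := fun x hx => by
    rw [scaledKernel_eq_zero hs, mul_zero]
    rw [mem_ball, dist_eq_norm] at hx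
    linarith
  rw [setIntegral_eq_integral_of_forall_compl_eq_zero h1]
  have h2 : ∀ x, u x * scaledKernel d a s x
      = (fun y => w (a + s • y) * radialKernel d y) (s⁻¹ • (x - a)) := by
    intro x
    simp only [smul_smul, mul_inv_cancel₀ hs.ne', one_smul, add_sub_cancel]
    by_cases hx : x ∈ ball a (s * (3 / 4))
    · rw [hws x hx]; rfl
    · have : scaledKernel d a s x = 0 := scaledKernel_eq_zero hs (by
        rw [mem_ball, dist_eq_norm] at hx
        linarith)
      rw [this, show radialKernel d (s⁻¹ • (x - a)) = 0 from this, mul_zero, mul_zero]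
  simp_rw [h2]
  rw [integral_sub_right_eq_self
    (fun x => (fun y => w (a + s • y) * radialKernel d y) (s⁻¹ • x)) a,
    Measure.integral_comp_inv_smul_of_nonneg volume
      (fun y => w (a + s • y) * radialKernel d y) hs.le, key]
  simp
  ring

namespace GFF

variable {d : ℕ} {Ω : Type} [MeasurableSpace Ω] (X : GFF d Ω)

/-- The second moment of the field on the unit ball tested against `f`. -/
def fieldVar (f : Euc d → ℝ) : ℝ := ∫ ω, X.h 0 1 f ω ^ 2 ∂X.P

lemma fieldVar_nonneg (f : Euc d → ℝ) : 0 ≤ X.fieldVar f :=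
  integral_nonneg fun _ => sq_nonneg _

lemma memLp_h {f : Euc d → ℝ} (hf : IsTestFun f) : MemLp (X.h 0 1 f) 2 X.P := by
  have hm := (X.meas_h 0 1 f).aestronglyMeasurable (μ := X.P)
  rw [memLp_two_iff_integrable_sq hm]
  refine Integrable.mono' ((X.mom4 f hf).add (integrable_const 1)) (hm.pow 2)
    (Eventually.of_forall fun ω => ?_)
  rw [Real.norm_of_nonneg (sq_nonneg _)]
  simp only [Pi.add_apply]
  nlinarith [sq_nonneg (X.h 0 1 f ω ^ 2 - 1), sq_nonneg (X.h 0 1 f ω)]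

lemma identDistrib_H {a : Euc d} {r : ℝ} (hr : 0 < r) (hB : ball a r ⊆ ball (0 : Euc d) 1)
    {f : Euc d → ℝ} (hf : IsTestFun f) :
    IdentDistrib (X.H a r fun x => f (r⁻¹ • (x - a)))
      (fun ω => r ^ (1 + (d : ℝ) / 2) * X.h 0 1 f ω) X.P X.P := by
  have h1 := X.dmp_law a r hr hB 1 (fun _ x => f (r⁻¹ • (x - a))) fun _ => hf.comp_affine a hr
  have h2 := X.scaling a r hr 1 (fun _ => f) fun _ => hf
  have h3 : IdentDistrib (fun ω (_ : Fin 1) => X.H a r (fun x => f (r⁻¹ • (x - a))) ω)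
      (fun ω (_ : Fin 1) => r ^ (1 + (d : ℝ) / 2) * X.h 0 1 f ω) X.P X.P :=
    ⟨(measurable_pi_lambda _ fun _ => X.meas_H _ _ _).aemeasurable,
      (measurable_pi_lambda _ fun _ => (X.meas_h _ _ _).const_mul _).aemeasurable, h1.trans h2⟩
  exact h3.comp (measurable_pi_apply 0)

lemma fieldVar_rescale {a : Euc d} {r : ℝ} (hr : 0 < r) (hB : ball a r ⊆ ball (0 : Euc d) 1)
    {f : Euc d → ℝ} (hf : IsTestFun f) :
    MemLp (X.Φ a r fun x => f (r⁻¹ • (x - a))) 2 X.P ∧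
      X.fieldVar (fun x => f (r⁻¹ • (x - a)))
        = r ^ (2 + d) * X.fieldVar f + ∫ ω, X.Φ a r (fun x => f (r⁻¹ • (x - a))) ω ^ 2 ∂X.P := by
  set g : Euc d → ℝ := fun x => f (r⁻¹ • (x - a)) with hg_def
  have hg : IsTestFun g := hf.comp_affine a hr
  have hid := X.identDistrib_H hr hB hf
  have hH : MemLp (X.H a r g) 2 X.P := hid.memLp_iff.2 ((X.memLp_h hf).const_mul _)
  have hdec := X.dmp_decomp a r hr hB g hg
  have hΦ : MemLp (X.Φ a r g) 2 X.P := by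
    refine ((X.memLp_h hg).sub hH).ae_eq ?_
    filter_upwards [hdec] with ω hω
    simp [hω]
  refine ⟨hΦ, ?_⟩
  have hindep : IndepFun (X.H a r g) (X.Φ a r g) X.P := by
    rw [IndepFun_iff_Indep]
    exact indep_of_indep_of_le (X.dmp_indep a r hr hB)
      (le_iSup (fun f : {f : Euc d → ℝ // IsTestFun f} =>
        MeasurableSpace.comap (X.H a r f.1) inferInstance) ⟨g, hg⟩)
      (le_sup_of_le_left (le_iSup (fun f : {f : Euc d → ℝ // IsTestFun f} =>
        MeasurableSpace.comap (X.Φ a r f.1) inferInstance) ⟨g, hg⟩))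
  have hmean : ∫ ω, X.H a r g ω ∂X.P = 0 := by
    rw [hid.integral_eq, integral_const_mul, X.centered 0 1 f hf, mul_zero]
  have hcross : ∫ ω, X.H a r g ω * X.Φ a r g ω ∂X.P = 0 := by
    rw [hindep.integral_fun_mul_eq_mul_integral hH.1 hΦ.1, hmean, zero_mul]
  have hsq : ∫ ω, X.H a r g ω ^ 2 ∂X.P = r ^ (2 + d) * X.fieldVar f := by
    rw [hid.sq.integral_eq, fieldVar, ← integral_const_mul]
    refine integral_congr_ae (Eventually.of_forall fun ω => ?_)
    simp only [mul_pow]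
    rw [← Real.rpow_natCast, ← Real.rpow_mul hr.le, ← Real.rpow_natCast r]
    congr 2
    push_cast
    ring
  have hexp : X.fieldVar g = ∫ ω, ((X.H a r g ω ^ 2 + 2 * (X.H a r g ω * X.Φ a r g ω))
      + X.Φ a r g ω ^ 2) ∂X.P := by
    refine integral_congr_ae ?_
    filter_upwards [hdec] with ω hω
    rw [hω]
    ring
  have hHΦ : Integrable (fun ω => X.H a r g ω * X.Φ a r g ω) X.P := hH.integrable_mul hΦ
  have hsum : Integrable (fun ω => X.H a r g ω ^ 2 + 2 * (X.H a r g ω * X.Φ a r g ω)) X.P :=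
    hH.integrable_sq.add (hHΦ.const_mul 2)
  rw [hexp, integral_add hsum hΦ.integrable_sq,
    integral_add hH.integrable_sq (hHΦ.const_mul 2), integral_const_mul, hcross, hsq]
  ring

lemma scaledKernel_rescale (a b : Euc d) {r s : ℝ} (hr : r ≠ 0) :
    (fun x => scaledKernel d b (s / r) (r⁻¹ • (x - a))) = scaledKernel d (a + r • b) s := by
  funext x
  simp only [scaledKernel]
  congr 1
  rw [show r⁻¹ • (x - a) - b = r⁻¹ • (x - (a + r • b)) by
    rw [← sub_sub, smul_sub r⁻¹ (x - a), inv_smul_smul₀ hr], smul_smul]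
  congr 1
  field_simp

lemma fieldVar_scaledKernel (hd : 2 ≤ d) {a : Euc d} {r s : ℝ} (hs : 0 < s) (hsr : s ≤ r)
    (hB : ball a r ⊆ ball (0 : Euc d) 1) :
    Integrable (fun ω => X.φharm a r ω a ^ 2) X.P ∧
      X.fieldVar (scaledKernel d a s) = r ^ (2 + d) * X.fieldVar (scaledKernel d 0 (s / r))
        + (s ^ d * ∫ y, radialKernel d y) ^ 2 * ∫ ω, X.φharm a r ω a ^ 2 ∂X.P := by
  have hr : 0 < r := hs.trans_le hsr
  have hM := integral_radialKernel_pos hd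
  obtain ⟨h1, h2⟩ := X.fieldVar_rescale hr hB (isTestFun_scaledKernel (0 : Euc d) (div_pos hs hr))
  rw [scaledKernel_rescale a 0 hr.ne', smul_zero, add_zero] at h1 h2
  have hae : ∀ᵐ ω ∂X.P, X.Φ a r (scaledKernel d a s) ω ^ 2
      = (s ^ d * ∫ y, radialKernel d y) ^ 2 * X.φharm a r ω a ^ 2 := by
    filter_upwards [X.dmp_harm a r hr hB] with ω hω
    rw [hω.2 _ (isTestFun_scaledKernel a hs) ((tsupport_scaledKernel a hs).trans
      (closedBall_subset_ball (by linarith))), setIntegral_mul_scaledKernel hs hsr hω.1]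
    ring
  have hc : (s ^ d * ∫ y, radialKernel d y) ^ 2 ≠ 0 := by positivity
  refine ⟨?_, ?_⟩
  · have := (h1.integrable_sq.congr hae).const_mul ((s ^ d * ∫ y, radialKernel d y) ^ 2)⁻¹
    simpa only [inv_mul_cancel_left₀ hc] using this
  · rw [h2, integral_congr_ae hae, integral_const_mul]

lemma fieldVar_scaledKernel_le_center {z : Euc d} (hz : ‖z‖ ≤ 1) {s : ℝ} (hs : 0 < s) :
    X.fieldVar (scaledKernel d z s) ≤ 2 ^ (2 + d) * X.fieldVar (scaledKernel d 0 (s / 2)) := by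
  have hB : ball (-((1 / 2 : ℝ) • z)) (1 / 2) ⊆ ball (0 : Euc d) 1 := by
    refine ball_subset_ball' ?_
    rw [dist_zero_right, norm_neg, norm_smul]
    norm_num
    linarith
  obtain ⟨-, h2⟩ := X.fieldVar_rescale (by norm_num) hB (isTestFun_scaledKernel z hs)
  have h3 := scaledKernel_rescale (-((1 / 2 : ℝ) • z)) z (r := 1 / 2) (s := s / 2) (by norm_num)
  rw [neg_add_cancel, show s / 2 / (1 / 2) = s by ring] at h3
  rw [h3] at h2
  have h4 : 0 ≤ ∫ ω, X.Φ (-((1 / 2 : ℝ) • z)) (1 / 2) (scaledKernel d 0 (s / 2)) ω ^ 2 ∂X.P :=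
    integral_nonneg fun _ => sq_nonneg _
  have h5 : (2 : ℝ) ^ (2 + d) * (1 / 2) ^ (2 + d) = 1 := by
    rw [← mul_pow]; norm_num
  rw [h2, mul_add, ← mul_assoc, h5, one_mul]
  have : (0 : ℝ) ≤ 2 ^ (2 + d) := by positivity
  nlinarith [mul_nonneg this h4]

lemma fieldVar_halving (hd : 2 ≤ d) {r : ℝ} (hr : 0 < r) (hr1 : r ≤ 1) :
    X.fieldVar (scaledKernel d 0 (r / 2))
      ≤ r ^ (2 + d) * X.fieldVar (scaledKernel d 0 (1 / 2))
        + X.fieldVar (scaledKernel d 0 r) / 4 ^ d := by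
  have hB : ball (0 : Euc d) r ⊆ ball 0 1 := ball_subset_ball hr1
  have h1 := (X.fieldVar_scaledKernel hd hr le_rfl hB).2
  have h2 := (X.fieldVar_scaledKernel hd (half_pos hr) (by linarith) hB).2
  rw [show r / 2 / r = 1 / 2 by field_simp] at h2
  rw [h2, h1]
  have h3 : ((r / 2) ^ d * ∫ y, radialKernel d y) ^ 2
      = (r ^ d * ∫ y, radialKernel d y) ^ 2 / 4 ^ d := by
    rw [show (4 : ℝ) = 2 ^ 2 by norm_num, ← pow_mul, mul_comm 2 d, pow_mul, div_pow]
    field_simp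
  rw [h3, add_div]
  have h4 := X.fieldVar_nonneg (scaledKernel d 0 (r / r))
  have : 0 ≤ r ^ (2 + d) * X.fieldVar (scaledKernel d 0 (r / r)) / 4 ^ d := by positivity
  have h5 : (r ^ d * ∫ y, radialKernel d y) ^ 2 / 4 ^ d * (∫ ω, X.φharm 0 r ω 0 ^ 2 ∂X.P)
    = (r ^ d * ∫ y, radialKernel d y) ^ 2 * (∫ ω, X.φharm 0 r ω 0 ^ 2 ∂X.P) / 4 ^ d := by ring
  linarith

lemma fieldVar_dyadic_le (hd : 2 ≤ d) (m : ℕ) :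
    X.fieldVar (scaledKernel d 0 ((1 / 2) ^ m))
      ≤ ((1 / 2) ^ m) ^ (2 * d) * (X.fieldVar (scaledKernel d 0 1)
        + 4 ^ d * X.fieldVar (scaledKernel d 0 (1 / 2))
          * ∑ k ∈ Finset.range m, ((2 : ℝ) ^ k) ^ (d - 2)) := by
  induction m with
  | zero => simp
  | succ m ih =>
    have h := X.fieldVar_halving hd (r := (1 / 2) ^ m) (by positivity)
      (pow_le_one₀ (by norm_num) (by norm_num))
    rw [show ((1 : ℝ) / 2) ^ m / 2 = (1 / 2) ^ (m + 1) by ring] at h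
    refine h.trans ?_
    have h1 := div_le_div_of_nonneg_right ih (show (0 : ℝ) ≤ 4 ^ d by positivity)
    refine (add_le_add le_rfl h1).trans (le_of_eq ?_)
    rw [Finset.sum_range_succ]
    have h2 : (((1 : ℝ) / 2) ^ (m + 1)) ^ (2 * d) = ((1 / 2) ^ m) ^ (2 * d) / 4 ^ d := by
      rw [pow_succ, mul_pow, pow_mul (1 / 2 : ℝ) 2 d, div_eq_mul_inv _ ((4 : ℝ) ^ d), ← inv_pow]
      norm_num
    have h3 : (((1 : ℝ) / 2) ^ m) ^ (2 + d)
        = ((1 / 2) ^ m) ^ (2 * d) * ((2 : ℝ) ^ m) ^ (d - 2) := by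
      obtain ⟨e, rfl⟩ := Nat.exists_eq_add_of_le hd
      rw [show 2 * (2 + e) = (2 + (2 + e)) + e by ring, pow_add _ _ e, mul_assoc,
        show 2 + e - 2 = e by lia, ← mul_pow, ← mul_pow]
      norm_num
    rw [h2, h3]
    have : (4 : ℝ) ^ d ≠ 0 := by positivity
    field_simp
    ring

/-- The variance of the harmonic part at the centre of a ball is bounded by a dyadic sum. -/
lemma exists_variance_le_dyadic_sum (hd : 2 ≤ d) :
    ∃ A B : ℝ, 0 ≤ A ∧ 0 ≤ B ∧ ∀ (z : Euc d) (ε : ℝ) (n : ℕ), ‖z‖ ≤ 1 → (1 / 2) ^ (n + 1) ≤ ε →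
      ball z ε ⊆ ball (0 : Euc d) 1 →
      Integrable (fun ω => X.φharm z ε ω z ^ 2) X.P ∧
      ∫ ω, X.φharm z ε ω z ^ 2 ∂X.P
        ≤ A + B * ∑ k ∈ Finset.range (n + 2), ((2 : ℝ) ^ k) ^ (d - 2) := by
  have hM := integral_radialKernel_pos hd
  set M := ∫ y, radialKernel d y
  set F1 := X.fieldVar (scaledKernel d 0 1)
  set F2 := X.fieldVar (scaledKernel d 0 (1 / 2))
  have hF1 : 0 ≤ F1 := X.fieldVar_nonneg _
  have hF2 : 0 ≤ F2 := X.fieldVar_nonneg _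
  refine ⟨(M ^ 2)⁻¹ * 2 ^ (2 + d) * F1, (M ^ 2)⁻¹ * 2 ^ (2 + d) * (4 ^ d * F2), by positivity,
    by positivity, ?_⟩
  intro z ε n hz hε hB
  set S := ∑ k ∈ Finset.range (n + 2), ((2 : ℝ) ^ k) ^ (d - 2)
  have hS : 0 ≤ S := Finset.sum_nonneg fun _ _ => by positivity
  have hs : (0 : ℝ) < (1 / 2) ^ (n + 1) := by positivity
  obtain ⟨hint, h1⟩ := X.fieldVar_scaledKernel hd hs hε hB
  refine ⟨hint, ?_⟩
  have h2 := X.fieldVar_scaledKernel_le_center hz hs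
  rw [show ((1 : ℝ) / 2) ^ (n + 1) / 2 = (1 / 2) ^ (n + 2) by ring] at h2
  have h3 := X.fieldVar_dyadic_le hd (n + 2)
  have h4 : 0 ≤ ε ^ (2 + d) * X.fieldVar (scaledKernel d 0 ((1 / 2) ^ (n + 1) / ε)) :=
    mul_nonneg (pow_nonneg (hs.le.trans hε) _) (X.fieldVar_nonneg _)
  have h5 : (((1 : ℝ) / 2) ^ (n + 2)) ^ (2 * d) ≤ (((1 / 2) ^ (n + 1)) ^ d) ^ 2 := by
    rw [← pow_mul _ d 2, mul_comm d 2]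
    exact pow_le_pow_left₀ (by positivity)
      (pow_le_pow_of_le_one (by norm_num) (by norm_num) (by lia)) _
  have h6 : 0 < (((1 : ℝ) / 2) ^ (n + 1)) ^ d := by positivity
  generalize (((1 : ℝ) / 2) ^ (n + 1)) ^ d = q at h1 h5 h6
  have h7 : (q * M) ^ 2 * ∫ ω, X.φharm z ε ω z ^ 2 ∂X.P
      ≤ 2 ^ (2 + d) * (q ^ 2 * (F1 + 4 ^ d * F2 * S)) := by
    have h8 : 0 ≤ F1 + 4 ^ d * F2 * S := by positivity
    calc _ ≤ X.fieldVar (scaledKernel d z ((1 / 2) ^ (n + 1))) := by linarith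
      _ ≤ _ := h2
      _ ≤ _ := by
        gcongr
        exact h3.trans (mul_le_mul_of_nonneg_right h5 h8)
  refine le_of_mul_le_mul_left (h7.trans (le_of_eq ?_)) (show 0 < (q * M) ^ 2 by positivity)
  field_simp

end GFF

lemma sum_two_pow_le {p : ℕ} (hp : p ≠ 0) (m : ℕ) :
    ∑ k ∈ Finset.range m, ((2 : ℝ) ^ k) ^ p ≤ (2 ^ m) ^ p := by
  induction m with
  | zero => simp
  | succ m ih =>
    rw [Finset.sum_range_succ, pow_succ (2 : ℝ) m, mul_pow]
    have h1 : (2 : ℝ) ≤ 2 ^ p := le_self_pow₀ (by norm_num) hp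
    have h2 : (0 : ℝ) ≤ (2 ^ m) ^ p := by positivity
    nlinarith

/-- The dyadic sum of `2^{k(d-2)}` down to scale `ε ≥ cR` is controlled by `1 + s(R)`. -/
lemma exists_dyadic_sum_le {d : ℕ} (hd : 2 ≤ d) {c : ℝ} (hc : 0 < c) :
    ∃ D : ℝ, ∀ (R ε : ℝ) (n : ℕ), 0 < R → R < 2 → c * R ≤ ε → ε ≤ (1 / 2) ^ n →
      ∑ k ∈ Finset.range (n + 2), ((2 : ℝ) ^ k) ^ (d - 2) ≤ D * (1 + sFun d R) := by
  rcases hd.eq_or_lt with rfl | hd3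
  · have hl := Real.log_pos one_lt_two
    have hl2 : 0 < 1 - Real.log 2 := by linarith [Real.log_two_lt_d9]
    set L := (Real.log 2)⁻¹
    have hL : 0 < L := inv_pos.2 hl
    set a := 2 - L * Real.log c
    refine ⟨|a - L| / (1 - Real.log 2) + L, fun R ε n hR hR2 hcε hε => ?_⟩
    have h1 : Real.log (c * R) ≤ Real.log ((1 / 2) ^ n) :=
      Real.log_le_log (by positivity) (hcε.trans hε)
    rw [Real.log_mul hc.ne' hR.ne', Real.log_pow, one_div, Real.log_inv] at h1
    have h2 : (n : ℝ) ≤ L * (-Real.log c - Real.log R) := by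
      rw [← div_eq_inv_mul, le_div_iff₀ hl]
      linarith
    have h3 := Real.log_lt_log hR hR2
    have h4 : |a - L| ≤ |a - L| / (1 - Real.log 2) * (1 - Real.log R) := by
      rw [div_mul_eq_mul_div, le_div_iff₀ hl2]
      exact mul_le_mul_of_nonneg_left (by linarith) (abs_nonneg _)
    have h5 := le_abs_self (a - L)
    simp only [sFun, if_true, Nat.sub_self, pow_zero, Finset.sum_const, Finset.card_range,
      nsmul_eq_mul, mul_one]
    push_cast
    simp only [a] at *
    nlinarith
  · obtain ⟨p, rfl⟩ := Nat.exists_eq_add_of_le hd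
    have hp : p ≠ 0 := by lia
    refine ⟨(4 / c) ^ p, fun R ε n hR hR2 hcε hε => ?_⟩
    rw [Nat.add_sub_cancel_left]
    have h1 : (2 : ℝ) ^ (n + 2) ≤ 4 / c * R⁻¹ := by
      have h2 : c * R * 2 ^ n ≤ 1 := by
        have := mul_le_mul_of_nonneg_right (hcε.trans hε) (show (0 : ℝ) ≤ 2 ^ n by positivity)
        rwa [← mul_pow, show (1 / 2 : ℝ) * 2 = 1 by norm_num, one_pow] at this
      rw [← div_eq_mul_inv, div_div, le_div_iff₀ (by positivity), pow_add]
      linarith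
    have h3 : sFun (2 + p) R = R⁻¹ ^ p := by
      rw [sFun, if_neg (by lia), inv_pow, ← Real.rpow_natCast, ← Real.rpow_neg hR.le]
      congr 1
      push_cast
      ring
    calc _ ≤ ((2 : ℝ) ^ (n + 2)) ^ p := sum_two_pow_le hp _
      _ ≤ (4 / c * R⁻¹) ^ p := pow_le_pow_left₀ (by positivity) h1 _
      _ = (4 / c) ^ p * sFun (2 + p) R := by rw [mul_pow, h3]
      _ ≤ _ := mul_le_mul_of_nonneg_left (by linarith) (by positivity)

lemma exists_const_le_one_add_sFun (d : ℕ) {A : ℝ} (hA : 0 ≤ A) :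
    ∃ D : ℝ, ∀ R : ℝ, 0 < R → R < 2 → A ≤ D * (1 + sFun d R) := by
  have hl2 : 0 < 1 - Real.log 2 := by linarith [Real.log_two_lt_d9]
  refine ⟨A / (1 - Real.log 2), fun R hR hR2 => ?_⟩
  rw [div_mul_eq_mul_div, le_div_iff₀ hl2]
  refine mul_le_mul_of_nonneg_left ?_ hA
  have h0 := Real.log_pos one_lt_two
  unfold sFun
  split_ifs
  · linarith [Real.log_lt_log hR hR2]
  · have := Real.rpow_pos_of_pos hR (2 - (d : ℝ))
    linarith

/-- the crude upper bound for the two-point function. -/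
theorem statement4 (d : ℕ) (hd : 2 ≤ d) (Ω : Type) [MeasurableSpace Ω] (X : GFF d Ω) (δ : ℝ) (hδ : 0 < δ) :
    ∃ C : ℝ, ∀ z₁ z₂ : Euc d, ‖z₁‖ < 1 - δ → ‖z₂‖ < 1 - δ → z₁ ≠ z₂ →
      |X.k2 z₁ z₂| ≤ C * (1 + sFun d ‖z₁ - z₂‖) := by
  obtain ⟨A, B, hA, hB, hvar⟩ := X.exists_variance_le_dyadic_sum hd
  have hc : 0 < min (1 / 4) (δ / 4) := by positivity
  obtain ⟨D, hD⟩ := exists_dyadic_sum_le hd hc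
  obtain ⟨D', hD'⟩ := exists_const_le_one_add_sFun d hA
  refine ⟨D' + B * D, fun z₁ z₂ h₁ h₂ hne => ?_⟩
  set R := ‖z₁ - z₂‖ with hR_def
  have hR : 0 < R := norm_pos_iff.2 (sub_ne_zero.2 hne)
  have hR2 : R < 2 := by linarith [norm_sub_le z₁ z₂]
  set ε := k2eps z₁ z₂ with hε_def
  have hεe : ε = min (R / 2) (min (1 - ‖z₁‖) (1 - ‖z₂‖)) / 2 := by
    rw [hε_def, k2eps, dist_eq_norm]
  have hcε : min (1 / 4) (δ / 4) * R ≤ ε := by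
    have h3 : min (1 / 4) (δ / 4) * R ≤ 1 / 4 * R :=
      mul_le_mul_of_nonneg_right (min_le_left _ _) hR.le
    have h4 : min (1 / 4) (δ / 4) * R ≤ δ / 4 * R :=
      mul_le_mul_of_nonneg_right (min_le_right _ _) hR.le
    rw [hεe, le_div_iff₀ two_pos]
    refine le_min (by linarith) (le_min ?_ ?_) <;> nlinarith
  have hε0 : 0 < ε := (mul_pos hc hR).trans_le hcε
  have hε₁ : 2 * ε ≤ 1 - ‖z₁‖ := by
    rw [hεe]
    linarith [(min_le_right (R / 2) (min (1 - ‖z₁‖) (1 - ‖z₂‖))).trans (min_le_left _ _)]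
  have hε₂ : 2 * ε ≤ 1 - ‖z₂‖ := by
    rw [hεe]
    linarith [(min_le_right (R / 2) (min (1 - ‖z₁‖) (1 - ‖z₂‖))).trans (min_le_right _ _)]
  obtain ⟨n, hn1, hn2⟩ := exists_nat_pow_near_of_lt_one hε0
    (by linarith [norm_nonneg z₁]) (show (0 : ℝ) < 1 / 2 by norm_num) (by norm_num)
  have hball : ∀ z : Euc d, 2 * ε ≤ 1 - ‖z‖ → ball z ε ⊆ ball (0 : Euc d) 1 := fun z hz =>
    ball_subset_ball' (by rw [dist_zero_right]; linarith)
  have hbound := hD R ε n hR hR2 hcε hn2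
  obtain ⟨hi₁, hv₁⟩ := hvar z₁ ε n (by linarith) hn1.le (hball z₁ hε₁)
  obtain ⟨hi₂, hv₂⟩ := hvar z₂ ε n (by linarith) hn1.le (hball z₂ hε₂)
  calc |X.k2 z₁ z₂| ≤ ∫ ω, |X.φharm z₁ ε ω z₁ * X.φharm z₂ ε ω z₂| ∂X.P :=
        abs_integral_le_integral_abs
    _ ≤ ∫ ω, (X.φharm z₁ ε ω z₁ ^ 2 + X.φharm z₂ ε ω z₂ ^ 2) / 2 ∂X.P := by
        refine integral_mono_of_nonneg (Eventually.of_forall fun ω => abs_nonneg _)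
          ((hi₁.add hi₂).div_const 2) (Eventually.of_forall fun ω => ?_)
        simp only [abs_mul]
        rw [← sq_abs (X.φharm z₁ ε ω z₁), ← sq_abs (X.φharm z₂ ε ω z₂)]
        linarith [two_mul_le_add_sq |X.φharm z₁ ε ω z₁| |X.φharm z₂ ε ω z₂|]
    _ = (∫ ω, X.φharm z₁ ε ω z₁ ^ 2 ∂X.P + ∫ ω, X.φharm z₂ ε ω z₂ ^ 2 ∂X.P) / 2 := by
        rw [integral_div, integral_add hi₁ hi₂]
    _ ≤ A + B * ∑ k ∈ Finset.range (n + 2), ((2 : ℝ) ^ k) ^ (d - 2) := by linarith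
    _ ≤ D' * (1 + sFun d R) + B * (D * (1 + sFun d R)) :=
        add_le_add (hD' R hR hR2) (mul_le_mul_of_nonneg_left hbound hB)
    _ = (D' + B * D) * (1 + sFun d R) := by ring
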